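/- Let M = (m_{s,t})_{s,t∈S} be a Coxeter matrix over a finite set S whose Coxeter group W_S is finite and whose Coxeter graph Γ_S is connected, and let A_S be the associated Artin-Tits group. Let X be a nonempty proper subset of S such that the induced Coxeter graph Γ_X has at least three connected components. Then the standard parabolic subgroup A_X is not conjugacy stable in A_S. -/

import Mathlib

namespace ArtinTits

variable {B : Type*}

/-- The alternating product `a b a b ⋯` with `m` factors, starting with `a`. -/
def altProd {G : Type*} [Monoid G] (a b : G) : ℕ → G
  | 0 => 1
  | n + 1 => a * altProd b a n

/-- The braid relations defining the Artin–Tits group of a Coxeter matrix: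
`Π(σ_s, σ_t; m_{s,t}) = Π(σ_t, σ_s; m_{s,t})` whenever `m_{s,t} ≠ ∞` (here `∞` is coded by `0`). -/
def artinRelationsSet (M : CoxeterMatrix B) : Set (FreeGroup B) :=
  {r | ∃ s t : B, M s t ≠ 0 ∧
    r = altProd (FreeGroup.of s) (FreeGroup.of t) (M s t) *
        (altProd (FreeGroup.of t) (FreeGroup.of s) (M s t))⁻¹}

/-- The Artin–Tits group of a Coxeter matrix. -/
abbrev ArtinGroup (M : CoxeterMatrix B) : Type _ := PresentedGroup (artinRelationsSet M)

/-- The standard generator `σ_s` of the Artin–Tits group. -/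
def σ (M : CoxeterMatrix B) (s : B) : ArtinGroup M := PresentedGroup.of s

/-- The standard parabolic subgroup `A_X` of the Artin–Tits group. -/
def AP (M : CoxeterMatrix B) (X : Set B) : Subgroup (ArtinGroup M) :=
  Subgroup.closure (σ M '' X)

/-- The standard parabolic subgroup `W_X` of the Coxeter group. -/
def WP (M : CoxeterMatrix B) (X : Set B) : Subgroup M.Group :=
  Subgroup.closure (M.simple '' X)

/-- A subgroup `H ≤ G` is conjugacy stable if any two elements of `H` which are conjugate
in `G` are already conjugate by an element of `H`. -/
def IsConjugacyStable {G : Type*} [Group G] (H : Subgroup G) : Prop :=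
  ∀ a b : G, a ∈ H → b ∈ H → (∃ g : G, g⁻¹ * a * g = b) → ∃ h ∈ H, h⁻¹ * a * h = b

/-- Property `⋆_W` for the pair `(W_X, W_S)`. -/
def StarW (M : CoxeterMatrix B) (X : Set B) : Prop :=
  ∀ Y₁ Y₂ : Set B, Y₁ ⊆ X → Y₂ ⊆ X → ∀ w : M.Group,
    (fun x => w⁻¹ * x * w) '' (M.simple '' Y₁) = M.simple '' Y₂ →
    ∃ v ∈ WP M X, ∀ y ∈ Y₁, v⁻¹ * M.simple y * v = w⁻¹ * M.simple y * w

/-- Property `⋆_A` for the pair `(A_X, A_S)`. -/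
def StarA (M : CoxeterMatrix B) (X : Set B) : Prop :=
  ∀ Y₁ Y₂ : Set B, Y₁ ⊆ X → Y₂ ⊆ X → ∀ g : ArtinGroup M,
    (fun x => g⁻¹ * x * g) '' (σ M '' Y₁) = σ M '' Y₂ →
    ∃ h ∈ AP M X, ∀ y ∈ Y₁, h⁻¹ * σ M y * h = g⁻¹ * σ M y * g

/-- Adjacency in the Coxeter graph: `s` and `t` are joined by an edge iff `m_{s,t} ≥ 3`
(where the value `0` codes `∞`, which also gives an edge). -/
def Adj (M : CoxeterMatrix B) (s t : B) : Prop := s ≠ t ∧ M s t ≠ 2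

/-- `s` and `t` are connected by a path of the Coxeter graph staying inside `X`. -/
def ReachIn (M : CoxeterMatrix B) (X : Set B) (s t : B) : Prop :=
  Relation.ReflTransGen (fun a b => a ∈ X ∧ b ∈ X ∧ Adj M a b) s t

/-- The Coxeter graph induced on `X` is connected. -/
def ConnectedIn (M : CoxeterMatrix B) (X : Set B) : Prop :=
  ∀ s ∈ X, ∀ t ∈ X, ReachIn M X s t

/-- The Coxeter matrix `M` restricted to `X` is of the type of the Coxeter matrix `M'`,
i.e. there is a bijection transporting one to the other. -/
def IsOfType {B' : Type*} (M : CoxeterMatrix B) (X : Set B) (M' : CoxeterMatrix B') : Prop :=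
  ∃ e : X ≃ B', ∀ a b : X, M a.val b.val = M' (e a) (e b)

/-- The Coxeter matrix of type `Bₙ` with the paper's labelling: vertices `0, …, n-1`
(representing `s_1, …, s_n`), `m_{s_1, s_2} = 4` and `m_{s_i, s_{i+1}} = 3` for `i ≥ 2`. -/
def Bmat (n : ℕ) : CoxeterMatrix (Fin n) where
  M := Matrix.of fun i j : Fin n ↦
    if i = j then 1
      else (if (i.val = 0 ∧ j.val = 1) ∨ (j.val = 0 ∧ i.val = 1) then 4
        else (if (j : ℕ) + 1 = i ∨ (i : ℕ) + 1 = j then 3 else 2))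
  isSymm := by unfold Matrix.IsSymm; aesop
  diagonal := by simp
  off_diagonal := by aesop

/-- The Coxeter matrix of type `Dₙ` with the paper's labelling: vertices `0, …, n-1`
(representing `s_1, …, s_n`), with edges `{s_1, s_3}`, `{s_2, s_3}` and `{s_i, s_{i+1}}`
for `i ≥ 3`, all labelled `3`. -/
def Dmat (n : ℕ) : CoxeterMatrix (Fin n) where
  M := Matrix.of fun i j : Fin n ↦
    if i = j then 1
      else (if (i.val = 0 ∧ j.val = 2) ∨ (j.val = 0 ∧ i.val = 2) then 3
        else (if i.val = 0 ∨ j.val = 0 then 2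
          else (if (j : ℕ) + 1 = i ∨ (i : ℕ) + 1 = j then 3 else 2)))
  isSymm := by unfold Matrix.IsSymm; aesop
  diagonal := by simp
  off_diagonal := by aesop

end ArtinTits

namespace ArtinTits

section Helpers

open Matrix

section GroupLemmas

variable {G : Type*} [Group G]

lemma altProd_eq_pow_mul (a b : G) (ha : a * a = 1) (hb : b * b = 1) (n : ℕ) :
    altProd a b n = (a * b) ^ n * altProd b a n := by
  induction n generalizing a b with
  | zero => simp [altProd]
  | succ n ih =>
    have h1 : a * (b * a) ^ n = (a * b) ^ n * a := by
      have := (SemiconjBy.pow_right (show SemiconjBy a (b * a) (a * b) by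
        simp [SemiconjBy, mul_assoc]) n)
      exact this
    calc a * altProd b a n = a * (b * a) ^ n * altProd a b n := by
          rw [mul_assoc, ← ih b a hb ha]
      _ = (a * b) ^ n * a * altProd a b n := by rw [h1]
      _ = (a * b) ^ n * (a * (b * b)) * altProd a b n := by rw [hb, mul_one]
      _ = (a * b) ^ (n + 1) * (b * altProd a b n) := by rw [pow_succ]; simp only [mul_assoc]

lemma altProd_two_mul (a b : G) (k : ℕ) : altProd a b (2 * k) = (a * b) ^ k := by
  induction k with
  | zero => simp [altProd]
  | succ k ih =>
    rw [show 2 * (k + 1) = 2 * k + 1 + 1 by ring]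
    simp only [altProd]
    rw [ih, pow_succ', mul_assoc]

lemma isConj_of_altProd_eq (a b : G) (m : ℕ) (hm : Odd m)
    (h : altProd a b m = altProd b a m) : IsConj a b := by
  obtain ⟨k, rfl⟩ := hm
  have h1 : a * (b * a) ^ k = (b * (a * b) ^ k) := by
    simpa [altProd, altProd_two_mul] using h
  have h2 : a * (b * a) ^ k = (a * b) ^ k * a := 
    (SemiconjBy.pow_right (show SemiconjBy a (b * a) (a * b) by simp [SemiconjBy, mul_assoc]) k)
  rw [isConj_iff]
  refine ⟨(a * b) ^ k, ?_⟩
  rw [← h2, h1]; group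

end GroupLemmas

variable {B : Type*} (M : CoxeterMatrix B)

/-- The Gram matrix of the geometric representation. -/
noncomputable def K : Matrix B B ℝ := fun s t => - Real.cos (Real.pi / M s t)

lemma K_symm (s t : B) : K M s t = K M t s := by simp [K, M.symmetric s t]

lemma K_self (s : B) : K M s s = 1 := by simp [K]

lemma K_two {s t : B} (h : M s t = 2) : K M s t = 0 := by simp [K, h]

lemma M_cases {s t : B} (h : s ≠ t) (h2 : M s t ≠ 2) : M s t = 0 ∨ 3 ≤ M s t := by
  have := M.off_diagonal s t h
  omega

lemma K_le_of_le {s t : B} (n : ℕ) (hn : 2 ≤ n) (h : M s t = 0 ∨ n ≤ M s t) :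
    K M s t ≤ - Real.cos (Real.pi / n) := by
  have hpi := Real.pi_pos
  have hn0 : (0 : ℝ) < n := by positivity
  unfold K
  rw [neg_le_neg_iff]
  apply Real.cos_le_cos_of_nonneg_of_le_pi
  · positivity
  · exact div_le_self hpi.le (by exact_mod_cast (by omega : 1 ≤ n))
  · rcases h with h | h
    · rw [h]; simp; positivity
    · gcongr

lemma K_nonpos {s t : B} (h : s ≠ t) : K M s t ≤ 0 := by
  have := K_le_of_le M (s := s) (t := t) 2 le_rfl (by
    have := M.off_diagonal s t h; omega)
  simpa using this

lemma K_le_half {s t : B} (h : s ≠ t) (h2 : M s t ≠ 2) : K M s t ≤ - (1 / 2) := by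
  have := K_le_of_le M (s := s) (t := t) 3 (by norm_num) (M_cases M h h2)
  simpa using this

lemma K_le_sqrt {s t : B} (h : s ≠ t) (h2 : M s t ≠ 2) (ho : ¬ Odd (M s t)) :
    K M s t ≤ - (√2 / 2) := by
  have := K_le_of_le M (s := s) (t := t) 4 (by norm_num) (by
    rcases M_cases M h h2 with h | h
    · exact Or.inl h
    · right
      by_contra h4
      have : M s t = 3 := by omega
      exact ho (this ▸ by decide))
  simpa using this

section Rep

variable [Fintype B] [DecidableEq B]

/-- The coroot attached to `s`. -/
noncomputable def cor (s : B) : Module.Dual ℝ (B → ℝ) :=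
  (2 : ℝ) • (LinearMap.proj s ∘ₗ (K M).mulVecLin)

lemma cor_apply (s : B) (v : B → ℝ) : cor M s v = 2 * (K M *ᵥ v) s := by
  simp [cor]

lemma cor_single (s t : B) : cor M s (Pi.single t 1) = 2 * K M s t := by
  simp [cor_apply]

lemma cor_self (s : B) : cor M s (Pi.single s 1) = 2 := by
  simp [cor_single, K_self]

/-- The simple reflections. -/
noncomputable def rfl' (s : B) : (B → ℝ) ≃ₗ[ℝ] (B → ℝ) := Module.reflection (cor_self M s)

lemma rfl'_apply (s : B) (v : B → ℝ) :
    rfl' M s v = v - cor M s v • Pi.single s 1 := Module.reflection_apply _ _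

lemma rfl'_self (s : B) : rfl' M s (Pi.single s 1) = - Pi.single s 1 :=
  Module.reflection_apply_self _

lemma rfl'_mul_self (s : B) : rfl' M s * rfl' M s = 1 := by
  ext1 v
  exact Module.involutive_reflection (cor_self M s) v

lemma rfl'_pow (s t : B) : (rfl' M s * rfl' M t) ^ M s t = 1 := by
  by_cases hst : s = t
  · subst hst; simp [rfl'_mul_self]
  by_cases h0 : M s t = 0
  · simp [h0]
  by_cases h2 : M s t = 2
  · have hk : K M s t = 0 := K_two M h2
    have hk' : K M t s = 0 := by rw [K_symm, hk]
    ext1 v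
    rw [h2, pow_two]
    simp only [LinearEquiv.mul_apply, rfl'_apply, map_sub, map_smul, cor_single, K_self, hk, hk']
    simp
    module
  have h3 : 3 ≤ M s t := (M_cases M hst h2).resolve_left h0
  set m := M s t with hm
  set φ : ℝ := 2 * (Real.pi / m) with hφ
  have hpi := Real.pi_pos
  have hm3 : (3 : ℝ) ≤ m := by exact_mod_cast h3
  have hsin : Real.sin φ ≠ 0 := by
    apply ne_of_gt
    apply Real.sin_pos_of_pos_of_lt_pi
    · positivity
    · rw [hφ, ← mul_div_assoc, div_lt_iff₀ (by linarith)]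
      nlinarith
  have ht : 2 * Real.cos φ =
      cor M s (Pi.single t 1) * cor M t (Pi.single s 1) - 2 := by
    rw [cor_single, cor_single, K_symm M t s, K, ← hm, hφ, Real.cos_two_mul]
    ring
  have hS : ∀ n : ℤ, (Polynomial.Chebyshev.S ℝ n).eval (2 * Real.cos φ) * Real.sin φ
      = Real.sin ((n + 1) * φ) := fun n => Polynomial.Chebyshev.S_two_mul_real_cos φ n
  ext1 v
  have key := Module.reflection_mul_reflection_pow_apply (cor_self M s) (cor_self M t) m v
    (2 * Real.cos φ) ht
  change ((rfl' M s * rfl' M t) ^ m) v = _ at key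
  rw [key]
  rcases Nat.even_or_odd' m with ⟨k, hk | hk⟩
  · have e1 : ((m : ℤ) - 2) / 2 = k - 1 := by omega
    have e2 : ((m : ℤ) - 1) / 2 = k - 1 := by omega
    have z : (Polynomial.Chebyshev.S ℝ ((k : ℤ) - 1)).eval (2 * Real.cos φ) = 0 := by
      have := hS (k - 1)
      have e : (((k : ℤ) - 1 : ℤ) + 1 : ℝ) * φ = Real.pi := by
        rw [hφ]; push_cast
        have : (m : ℝ) = 2 * k := by exact_mod_cast hk
        field_simp
        rw [this]; ring
      rw [e, Real.sin_pi] at this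
      exact (mul_eq_zero.mp this).resolve_right hsin
    rw [e1, e2, z]
    simp
  · have e1 : ((m : ℤ) - 2) / 2 = k - 1 := by omega
    have e2 : ((m : ℤ) - 1) / 2 = k := by omega
    have e3 : ((m : ℤ) - 3) / 2 = k - 1 := by omega
    have e4 : (m : ℤ) / 2 = k := by omega
    have z : (Polynomial.Chebyshev.S ℝ (k : ℤ)).eval (2 * Real.cos φ)
        + (Polynomial.Chebyshev.S ℝ ((k : ℤ) - 1)).eval (2 * Real.cos φ) = 0 := by
      have h1 := hS k
      have h2 := hS (k - 1)
      have hmk : (m : ℝ) = 2 * k + 1 := by exact_mod_cast hk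
      have e : (((k : ℤ) - 1 : ℤ) + 1 : ℝ) * φ = Real.pi - Real.pi / m := by
        rw [hφ]; push_cast
        field_simp
        rw [hmk]; ring
      have e' : (((k : ℤ) : ℝ) + 1) * φ = Real.pi / m + Real.pi := by
        rw [hφ]; push_cast
        field_simp
        rw [hmk]; ring
      rw [e, Real.sin_pi_sub] at h2
      rw [e', Real.sin_add_pi] at h1
      have : ((Polynomial.Chebyshev.S ℝ (k : ℤ)).eval (2 * Real.cos φ)
        + (Polynomial.Chebyshev.S ℝ ((k : ℤ) - 1)).eval (2 * Real.cos φ)) * Real.sin φ = 0 := by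
        rw [add_mul, h1, h2]; ring
      exact (mul_eq_zero.mp this).resolve_right hsin
    rw [e1, e2, e3, e4, z]
    simp

/-- The geometric representation of the Coxeter group. -/
noncomputable def ρW : M.Group →* ((B → ℝ) ≃ₗ[ℝ] (B → ℝ)) :=
  M.toCoxeterSystem.lift ⟨rfl' M, fun s t => rfl'_pow M s t⟩

lemma ρW_simple (s : B) : ρW M (M.simple s) = rfl' M s := by
  rw [← M.toCoxeterSystem_simple]
  exact M.toCoxeterSystem.lift_apply_simple _ s

lemma map_altProd {G H : Type*} [Group G] [Group H] (f : G →* H) (a b : G) (n : ℕ) :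
    f (altProd a b n) = altProd (f a) (f b) n := by
  induction n generalizing a b with
  | zero => simp [altProd]
  | succ n ih => simp [altProd, ih]

/-- The geometric representation, pulled back to the Artin group. -/
noncomputable def ρA : ArtinGroup M →* ((B → ℝ) ≃ₗ[ℝ] (B → ℝ)) :=
  PresentedGroup.toGroup (f := rfl' M) (by
    rintro r ⟨s, t, -, rfl⟩
    rw [map_mul, map_inv, map_altProd, map_altProd, FreeGroup.lift_apply_of,
      FreeGroup.lift_apply_of,
      altProd_eq_pow_mul _ _ (rfl'_mul_self M s) (rfl'_mul_self M t), rfl'_pow]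
    simp)

lemma ρA_σ (s : B) : ρA M (σ M s) = rfl' M s := PresentedGroup.toGroup.of _

/-- Invariant inner product. -/
noncomputable def Q [Fintype M.Group] : LinearMap.BilinForm ℝ (B → ℝ) :=
  ∑ w : M.Group, (dotProductBilin ℝ ℝ).compl₁₂ (ρW M w).toLinearMap (ρW M w).toLinearMap

lemma Q_apply [Fintype M.Group] (x y : B → ℝ) :
    Q M x y = ∑ w : M.Group, (ρW M w x) ⬝ᵥ (ρW M w y) := by
  simp [Q, LinearMap.sum_apply]

lemma Q_symm [Fintype M.Group] (x y : B → ℝ) : Q M x y = Q M y x := by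
  simp [Q_apply, dotProduct_comm]

lemma Q_inv [Fintype M.Group] (s : B) (x y : B → ℝ) :
    Q M (rfl' M s x) (rfl' M s y) = Q M x y := by
  rw [Q_apply, Q_apply, ← Equiv.sum_comp (Equiv.mulRight (M.simple s))
    (fun w => (ρW M w x) ⬝ᵥ (ρW M w y))]
  simp [ρW_simple]

lemma Q_pos [Fintype M.Group] (x : B → ℝ) (hx : x ≠ 0) : 0 < Q M x x := by
  rw [Q_apply]
  apply Finset.sum_pos
  · intro w _
    have h : ρW M w x ≠ 0 := by simpa using hx
    have h1 : 0 ≤ ρW M w x ⬝ᵥ ρW M w x :=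
      Finset.sum_nonneg fun i _ => mul_self_nonneg _
    exact lt_of_le_of_ne h1 (fun h2 => h (dotProduct_self_eq_zero.mp h2.symm))
  · exact ⟨1, Finset.mem_univ _⟩

lemma Q_single [Fintype M.Group] (s : B) (x : B → ℝ) :
    2 * Q M (Pi.single s 1) x = Q M (Pi.single s 1) (Pi.single s 1) * cor M s x := by
  have h := Q_inv M s (Pi.single s 1) x
  rw [rfl'_self, rfl'_apply] at h
  simp only [map_neg, LinearMap.neg_apply, map_sub, map_smul, smul_eq_mul] at h
  linarith

lemma posdef [Finite M.Group] (hconn : ConnectedIn M Set.univ) (v : B → ℝ) (hv : v ≠ 0) :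
    0 < v ⬝ᵥ (K M *ᵥ v) := by
  have := Fintype.ofFinite M.Group
  have hadj : ∀ s t, Adj M s t → Q M (Pi.single s 1) (Pi.single s 1)
      = Q M (Pi.single t 1) (Pi.single t 1) := by
    rintro s t ⟨h1, h2⟩
    have hs := Q_single M s (Pi.single t 1)
    have ht := Q_single M t (Pi.single s 1)
    rw [Q_symm, cor_single, K_symm] at ht
    rw [cor_single] at hs
    have hk := K_le_half M h1 h2
    have : (Q M (Pi.single s 1) (Pi.single s 1)
      - Q M (Pi.single t 1) (Pi.single t 1)) * K M s t = 0 := by linarith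
    rcases mul_eq_zero.mp this with h | h <;> linarith
  have hreach : ∀ s t, ReachIn M Set.univ s t → Q M (Pi.single s 1) (Pi.single s 1)
      = Q M (Pi.single t 1) (Pi.single t 1) := by
    intro s t h
    induction h with
    | refl => rfl
    | tail _ h ih => rw [ih]; exact hadj _ _ h.2.2
  obtain ⟨s0, hs0⟩ := Function.ne_iff.mp hv
  set c := Q M (Pi.single s0 1) (Pi.single s0 1) with hc
  have hcpos : 0 < c := Q_pos M _ (by simp)
  have hQ : ∀ s, Q M (Pi.single s 1) v = c * (K M *ᵥ v) s := by
    intro s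
    have h := Q_single M s v
    rw [← hreach s0 s (hconn s0 trivial s trivial), cor_apply] at h
    linarith
  have hvv : Q M v v = c * (v ⬝ᵥ (K M *ᵥ v)) := by
    have : Q M v v = Q M (∑ s, v s • Pi.single s (1 : ℝ)) v := by
      congr 2
      ext i; simp [Finset.sum_apply, Pi.single_apply]
    rw [this]
    simp only [map_sum, map_smul, LinearMap.sum_apply, LinearMap.smul_apply, hQ, dotProduct,
      Finset.mul_sum, smul_eq_mul]
    exact Finset.sum_congr rfl fun i _ => by ring
  have := Q_pos M v hv
  rw [hvv] at this
  exact pos_of_mul_pos_right this hcpos.le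

end Rep

/-- The graph of odd edges. -/
def OG : SimpleGraph B where
  Adj s t := s ≠ t ∧ Odd (M s t)
  symm := ⟨fun s t h => ⟨h.1.symm, by rw [M.symmetric]; exact h.2⟩⟩
  loopless := ⟨fun s h => h.1 rfl⟩

lemma isConj_of_reachable {s t : B} (h : (OG M).Reachable s t) : IsConj (σ M s) (σ M t) := by
  rw [SimpleGraph.reachable_iff_reflTransGen] at h
  induction h with
  | refl => exact IsConj.refl _
  | @tail b c _ h ih =>
    refine ih.trans (isConj_of_altProd_eq _ _ _ h.2 ?_)
    have hrel : altProd (FreeGroup.of b) (FreeGroup.of c) (M b c) *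
        (altProd (FreeGroup.of c) (FreeGroup.of b) (M b c))⁻¹ ∈ artinRelationsSet M :=
      ⟨b, c, h.2.pos.ne', rfl⟩
    have h1 := PresentedGroup.one_of_mem hrel
    rw [map_mul, map_inv, map_altProd, map_altProd, mul_inv_eq_one] at h1
    exact h1

lemma sum_component_le [Fintype B] [DecidableEq B] (C : (OG M).ConnectedComponent)
    [DecidablePred (· ∈ C.supp)] :
    ∑ s : C.supp, ∑ t : C.supp, K M s t ≤ 1 := by
  classical
  let H : SimpleGraph C.supp := C.toSimpleGraph
  have hH : H.Connected := C.connected_toSimpleGraph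
  have h1 := hH.card_vert_le_card_edgeSet_add_one
  have h2 := H.sum_degrees_eq_twice_card_edges
  rw [Nat.card_eq_fintype_card, Nat.card_eq_fintype_card, ← SimpleGraph.edgeFinset_card] at h1
  have hk : ∀ s t : C.supp, K M s t ≤ (if s = t then 1 else 0)
      - (1 / 2) * (if H.Adj s t then 1 else 0) := by
    intro s t
    by_cases hst : s = t
    · subst hst; simp [K_self]
    · have hst' : (s : B) ≠ t := fun h => hst (Subtype.ext h)
      by_cases ha : H.Adj s t
      · have ha' : (OG M).Adj s t := ha
        simp only [hst, ha, if_true, if_false]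
        have := K_le_half M hst' (fun h => by have := ha'.2; rw [h] at this; revert this; decide)
        linarith
      · simp only [hst, ha, if_false]
        simpa using K_nonpos M hst'
  have hdeg : ∀ s : C.supp, ∑ t : C.supp, (if H.Adj s t then (1 : ℝ) else 0) = H.degree s := by
    intro s
    rw [Finset.sum_boole, ← SimpleGraph.card_neighborFinset_eq_degree,
      SimpleGraph.neighborFinset_eq_filter]
  calc ∑ s : C.supp, ∑ t : C.supp, K M s t
      ≤ ∑ s : C.supp, ∑ t : C.supp, ((if s = t then (1 : ℝ) else 0)
      - (1 / 2) * (if H.Adj s t then 1 else 0)) :=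
        Finset.sum_le_sum fun s _ => Finset.sum_le_sum fun t _ => hk s t
    _ = Fintype.card C.supp - (1 / 2) * ((∑ s, H.degree s : ℕ) : ℝ) := by
        simp only [Finset.sum_sub_distrib, ← Finset.mul_sum, hdeg]
        simp
    _ ≤ 1 := by
        rw [h2]
        have : (Fintype.card C.supp : ℝ) ≤ H.edgeFinset.card + 1 := by exact_mod_cast h1
        push_cast
        linarith

lemma no_two_neighbours [Fintype B] [DecidableEq B] [Finite M.Group]
    (hconn : ConnectedIn M Set.univ)
    (C : (OG M).ConnectedComponent) (a c : B) (hac : a ≠ c) (ha : a ∉ C.supp) (hc : c ∉ C.supp)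
    (hea : ∃ b ∈ C.supp, Adj M b a) (hec : ∃ b ∈ C.supp, Adj M b c) : False := by
  classical
  set u : B → ℝ := fun s => if s ∈ C.supp then 1 else 0 with hu
  have hnb : ∀ x, x ∉ C.supp → (∃ b ∈ C.supp, Adj M b x) → (K M *ᵥ u) x ≤ -(√2 / 2) := by
    rintro x hx ⟨b, hb, hbx⟩
    have hodd : ¬ Odd (M b x) := by
      intro ho
      apply hx
      have : (OG M).Adj b x := ⟨hbx.1, ho⟩
      exact (C.mem_supp_congr_adj this).mp hb
    have hkb := K_le_sqrt M hbx.1 hbx.2 hodd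
    rw [K_symm] at hkb
    have : (K M *ᵥ u) x = ∑ t ∈ Finset.univ.filter (· ∈ C.supp), K M x t := by
      simp [mulVec, dotProduct, hu, Finset.sum_filter]
    rw [this]
    refine le_trans ?_ hkb
    have hbmem : b ∈ Finset.univ.filter (· ∈ C.supp) := by simpa using hb
    rw [← Finset.add_sum_erase _ _ hbmem]
    have : ∑ t ∈ (Finset.univ.filter (· ∈ C.supp)).erase b, K M x t ≤ 0 := by
      apply Finset.sum_nonpos
      intro t ht
      apply K_nonpos
      rintro rfl
      exact hx (by simpa using (Finset.mem_filter.mp (Finset.mem_of_mem_erase ht)).2)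
    linarith
  have huu : u ⬝ᵥ (K M *ᵥ u) ≤ 1 := by
    refine le_trans (le_of_eq ?_) (sum_component_le M C)
    have e : ∀ g : B → ℝ, ∑ s, u s * g s = ∑ s : C.supp, g s := by
      intro g
      rw [← Finset.sum_subtype (Finset.univ.filter (· ∈ C.supp)) (by simp) g, Finset.sum_filter]
      simp [hu]
    rw [dotProduct, e]
    refine Finset.sum_congr rfl fun s _ => ?_
    rw [mulVec, dotProduct, ← e]
    exact Finset.sum_congr rfl fun t _ => mul_comm _ _
  have hKT : (K M)ᵀ = K M := by ext i j; exact K_symm M j i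
  have hsymm : ∀ x y : B → ℝ, x ⬝ᵥ (K M *ᵥ y) = y ⬝ᵥ (K M *ᵥ x) := by
    intro x y
    rw [dotProduct_mulVec, ← mulVec_transpose, hKT, dotProduct_comm]
  have h1 := hnb a ha hea
  have h2 := hnb c hc hec
  have h3 := K_nonpos M hac
  set v : B → ℝ := √2 • u + (Pi.single a 1 + Pi.single c 1) with hv
  have hv0 : v ≠ 0 := by
    intro h
    have := congrFun h a
    simp [hv, hu, hac] at this
    have h0 : 0 ≤ √2 := Real.sqrt_nonneg 2
    split_ifs at this <;> linarith
  have hpos := posdef M hconn v hv0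
  have hsa : Pi.single a 1 ⬝ᵥ (K M *ᵥ u) = (K M *ᵥ u) a := by simp
  have hsc : Pi.single c 1 ⬝ᵥ (K M *ᵥ u) = (K M *ᵥ u) c := by simp
  have haa : Pi.single a 1 ⬝ᵥ (K M *ᵥ (Pi.single a 1)) = 1 := by simp [K_self]
  have hcc : Pi.single c 1 ⬝ᵥ (K M *ᵥ (Pi.single c 1)) = 1 := by simp [K_self]
  have hacK : Pi.single a 1 ⬝ᵥ (K M *ᵥ (Pi.single c 1)) = K M a c := by simp
  rw [hv] at hpos
  simp only [mulVec_add, mulVec_smul, dotProduct_add, add_dotProduct, smul_dotProduct,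
    dotProduct_smul, smul_eq_mul, hsymm u (Pi.single a 1), hsymm u (Pi.single c 1),
    hsymm (Pi.single c 1) (Pi.single a 1), hsa, hsc, haa, hcc, hacK] at hpos
  have hsq : √2 * √2 = 2 := Real.mul_self_sqrt (by norm_num)
  have hs0 : 0 < √2 := by positivity
  have m1 : √2 * (K M *ᵥ u) a ≤ -1 := by
    have := mul_le_mul_of_nonneg_left h1 hs0.le
    linarith
  have m2 : √2 * (K M *ᵥ u) c ≤ -1 := by
    have := mul_le_mul_of_nonneg_left h2 hs0.le
    linarith
  have m3 : √2 * (√2 * (u ⬝ᵥ (K M *ᵥ u))) ≤ 2 := by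
    rw [← mul_assoc, hsq]; linarith
  linarith

lemma exists_exit (hconn : ConnectedIn M Set.univ) (P : Set B) (s t : B) (hs : s ∈ P)
    (ht : t ∉ P) : ∃ x ∈ P, ∃ y ∉ P, Adj M x y := by
  by_contra hcon
  push Not at hcon
  have h := hconn s trivial t trivial
  apply ht
  unfold ReachIn at h
  clear ht
  induction h with
  | refl => exact hs
  | @tail b c _ h ih =>
    by_contra hc
    exact hcon b ih c hc h.2.2

lemma Adj_symm {s t : B} (h : Adj M s t) : Adj M t s :=
  ⟨h.1.symm, by rw [M.symmetric]; exact h.2⟩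

lemma three_classes [Finite B] [Finite M.Group] (hconn : ConnectedIn M Set.univ) (a b c : B)
    (hab : ¬ (OG M).Reachable a b) (hac : ¬ (OG M).Reachable a c)
    (hbc : ¬ (OG M).Reachable b c) : False := by
  classical
  have := Fintype.ofFinite B
  let cl : B → (OG M).ConnectedComponent := (OG M).connectedComponentMk
  have hab' : cl a ≠ cl b := fun h => hab (SimpleGraph.ConnectedComponent.exact h)
  have hac' : cl a ≠ cl c := fun h => hac (SimpleGraph.ConnectedComponent.exact h)
  have hbc' : cl b ≠ cl c := fun h => hbc (SimpleGraph.ConnectedComponent.exact h)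
  obtain ⟨x, hx, y, hy, hxy⟩ := exists_exit M hconn {s | cl s = cl a} a b rfl hab'.symm
  have hx : cl x = cl a := hx
  have hy : cl y ≠ cl a := hy
  -- a third class
  obtain ⟨d, hd⟩ : ∃ d, cl d ≠ cl a ∧ cl d ≠ cl y := by
    by_cases h : cl y = cl b
    · exact ⟨c, hac'.symm, by rw [h]; exact hbc'.symm⟩
    · exact ⟨b, hab'.symm, fun h' => h h'.symm⟩
  obtain ⟨p, hp, q, hq, hpq⟩ := exists_exit M hconn {s | cl s = cl a ∨ cl s = cl y} a d
    (Or.inl rfl) (by rintro (h | h); exacts [hd.1 h, hd.2 h])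
  have hq1 : cl q ≠ cl a := fun h => hq (Or.inl h)
  have hq2 : cl q ≠ cl y := fun h => hq (Or.inr h)
  rcases hp with hp | hp
  · exact no_two_neighbours M hconn (cl a) y q (fun h => hq2 (h ▸ rfl)) hy hq1
      ⟨x, hx, hxy⟩ ⟨p, hp, hpq⟩
  · exact no_two_neighbours M hconn (cl y) x q (fun h => hq1 (h ▸ hx)) (fun h => hy (by
      rw [← hx]; exact (show cl x = cl y from h).symm)) hq2
      ⟨y, rfl, Adj_symm M hxy⟩ ⟨p, hp, hpq⟩

lemma not_conj_of_not_reach [Fintype B] [DecidableEq B] (X : Set B) (x y : B) (hx : x ∈ X)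
    (hy : y ∈ X) (hxy : ¬ ReachIn M X x y) (g : ArtinGroup M) (hg : g ∈ AP M X)
    (h : g * σ M x = σ M y * g) : False := by
  -- the coordinates supported on the component of `x`
  let P : (B → ℝ) → Prop := fun v => ∀ t, ¬ ReachIn M X x t → v t = 0
  have hmem : ∀ u, ReachIn M X x u → u ∈ X := by
    intro u hu
    induction hu with
    | refl => exact hx
    | tail _ h _ => exact h.2.1
  have hcor : ∀ t ∈ X, ¬ ReachIn M X x t → ∀ v, P v → cor M t v = 0 := by
    intro t ht hxt v hv
    rw [cor_apply, mulVec, dotProduct, Finset.sum_eq_zero, mul_zero]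
    intro u _
    by_cases hu : ReachIn M X x u
    · rw [K_two, zero_mul]
      by_contra h2
      apply hxt
      refine Relation.ReflTransGen.tail hu ⟨hmem u hu, ht, ?_, ?_⟩
      · rintro rfl; exact hxt hu
      · rw [M.symmetric]; exact h2
    · rw [hv u hu, mul_zero]
  have hrefl : ∀ t ∈ X, ∀ v, P v → P (rfl' M t v) := by
    intro t ht v hv
    rw [rfl'_apply]
    by_cases hxt : ReachIn M X x t
    · intro u hu
      have : u ≠ t := by rintro rfl; exact hu hxt
      simp [hv u hu, this]
    · rw [hcor t ht hxt v hv]; simpa using hv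
  have hinv : ∀ t, (rfl' M t)⁻¹ = rfl' M t := fun t =>
    inv_eq_of_mul_eq_one_left (rfl'_mul_self M t)
  have hpres : ∀ v, P v → P (ρA M g v) := by
    unfold AP at hg
    clear h
    induction hg using Subgroup.closure_induction'' with
    | one => simp
    | mem z hz =>
      obtain ⟨t, ht, rfl⟩ := hz
      rw [ρA_σ]; exact hrefl t ht
    | inv_mem z hz =>
      obtain ⟨t, ht, rfl⟩ := hz
      rw [map_inv, ρA_σ, hinv]; exact hrefl t ht
    | mul z w _ _ hz hw =>
      intro v hv
      rw [map_mul]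
      exact hz _ (hw _ hv)
  have hPx : P (Pi.single x 1) := by
    intro t ht
    have : t ≠ x := by rintro rfl; exact ht Relation.ReflTransGen.refl
    simp [this]
  have hw := hpres _ hPx
  have e := congrArg (fun f => ρA M f (Pi.single x 1)) h
  simp only [map_mul, ρA_σ, LinearEquiv.mul_apply, rfl'_self, map_neg] at e
  rw [rfl'_apply M y, hcor y hy hxy _ hw, zero_smul, sub_zero, neg_eq_self] at e
  have e' : (Pi.single x 1 : B → ℝ) = 0 := by simpa using e
  simpa using congrFun e' x

end Helpers

/-- Section 4.1 of the paper: if the induced Coxeter graph on `X` has at least three connected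
components, then `A_X` is not conjugacy stable in the irreducible Artin–Tits group `A_S` of
spherical type. -/
theorem not_conjugacy_stable_of_three_components
    {B : Type*} [Finite B] (M : CoxeterMatrix B) [Finite M.Group]
    (hconn : ConnectedIn M Set.univ)
    (X : Set B) (hX : X.Nonempty) (hXproper : X ≠ Set.univ)
    (h3 : ∃ a ∈ X, ∃ b ∈ X, ∃ c ∈ X,
      ¬ ReachIn M X a b ∧ ¬ ReachIn M X a c ∧ ¬ ReachIn M X b c) :
    ¬ IsConjugacyStable (AP M X) := by
  classical
  have := Fintype.ofFinite B
  intro hst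
  have key : ∀ x ∈ X, ∀ y ∈ X, ¬ ReachIn M X x y → ¬ (OG M).Reachable x y := by
    intro x hx y hy hxy hr
    have hc := isConj_of_reachable M hr
    obtain ⟨g, hg⟩ := isConj_iff.mp hc
    obtain ⟨h, hh, he⟩ := hst (σ M x) (σ M y) (Subgroup.subset_closure ⟨x, hx, rfl⟩)
      (Subgroup.subset_closure ⟨y, hy, rfl⟩) ⟨g⁻¹, by simpa using hg⟩
    refine not_conj_of_not_reach M X x y hx hy hxy h⁻¹ (inv_mem hh) ?_
    rw [← he]; group
  obtain ⟨a, ha, b, hb, c, hc, h1, h2, h3⟩ := h3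
  exact three_classes M hconn a b c (key a ha b hb h1) (key a ha c hc h2) (key b hb c hc h3)

end ArtinTits
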